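/- arXiv:1106.0811 — 2 statements merged into one kernel-verified Lean document; each statement's English description precedes it below -/
import Mathlib

section
/- Let G be a finite simple graph with vertex set V, with |V| ≥ 1. Then M(G) ≤ λmax(G) ≤ ((1/4)·log|V| + 1)·M(G). -/
-- `lamMax G`: the largest eigenvalue of the adjacency matrix of `G`.
open Classical in
noncomputable def lamMax {V : Type*} [Fintype V] (G : SimpleGraph V) : ℝ :=
  sSup (spectrum ℝ (G.adjMatrix ℝ))

-- `eXY G X Y = e(X,Y)`: the number of ordered pairs `(x,y) ∈ X × Y` with `x` adjacent to `y`.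
open Classical in
noncomputable def eXY {V : Type*} (G : SimpleGraph V) (X Y : Finset V) : ℕ :=
  ((X ×ˢ Y).filter fun p => G.Adj p.1 p.2).card

/-- `M(G)`: the maximum of `e(X,Y)/√(|X||Y|)` over nonempty `X, Y ⊆ V`. -/
noncomputable def MG {V : Type*} (G : SimpleGraph V) : ℝ :=
  sSup {r : ℝ | ∃ X Y : Finset V, X.Nonempty ∧ Y.Nonempty ∧
    r = (eXY G X Y : ℝ) / Real.sqrt ((X.card : ℝ) * (Y.card : ℝ))}

open Finset in
/-- A nonnegative function on a finite type is a nonnegative combination of indicators of nested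
level sets `S k` with `k + 1` elements; `y` lists its values in decreasing order. -/
lemma exists_layer_decomposition {V : Type*} [Fintype V] (x : V → ℝ) (hx : ∀ v, 0 ≤ x v) :
    ∃ (y : ℕ → ℝ) (S : ℕ → Finset V), y (Fintype.card V) = 0 ∧
      (∀ k, k < Fintype.card V → 0 ≤ y k - y (k + 1)) ∧
      (∀ k, k < Fintype.card V → (S k).card = k + 1) ∧
      (∀ f : V → ℝ, ∑ v, x v * f v =
        ∑ k ∈ range (Fintype.card V), (y k - y (k + 1)) * ∑ v ∈ S k, f v) ∧
      ∑ k ∈ range (Fintype.card V), y k ^ 2 = ∑ v, x v ^ 2 := by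
  classical
  set n := Fintype.card V with hn
  let e₀ : Fin n ≃ V := (Fintype.equivFin V).symm
  let e : Fin n ≃ V := (Tuple.sort fun i => -x (e₀ i)).trans e₀
  have anti : ∀ i j : Fin n, i ≤ j → x (e j) ≤ x (e i) := fun i j hij => by
    have := Tuple.monotone_sort (fun i => -x (e₀ i)) hij
    exact neg_le_neg_iff.1 this
  let y : ℕ → ℝ := fun k => if h : k < n then x (e ⟨k, h⟩) else 0
  have hy : ∀ i : Fin n, y i = x (e i) := fun i => by simp [y]
  have hyn : y n = 0 := by simp [y]
  refine ⟨y, fun k => (univ.filter fun i : Fin n => (i : ℕ) ≤ k).map e.toEmbedding, hyn,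
    ?_, ?_, ?_, ?_⟩
  · intro k hk
    by_cases h : k + 1 < n
    · have := anti ⟨k, hk⟩ ⟨k + 1, h⟩ (by simp)
      simpa [y, hk, h] using this
    · simpa [y, hk, h] using hx _
  · intro k hk
    rw [card_map]
    have : (univ.filter fun i : Fin n => (i : ℕ) ≤ k) = Finset.Iic ⟨k, hk⟩ := by
      ext i; simp [Fin.le_def]
    rw [this, Fin.card_Iic]
  · intro f
    have tele : ∀ i : Fin n,
        x (e i) = ∑ k ∈ range n, if (i : ℕ) ≤ k then y k - y (k + 1) else 0 := by
      intro i
      have hset : (range n).filter (fun k => (i : ℕ) ≤ k) = Ico (i : ℕ) n := by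
        ext k; simp [and_comm]
      rw [← sum_filter, hset, sum_Ico_eq_sub _ i.2.le, sum_range_sub', sum_range_sub', hyn, hy]
      ring
    rw [← Equiv.sum_comp e]
    simp_rw [sum_map, sum_filter]
    calc ∑ i, x (e i) * f (e i)
        = ∑ i : Fin n, ∑ k ∈ range n,
            (y k - y (k + 1)) * (if (i : ℕ) ≤ k then f (e i) else 0) := by
          refine sum_congr rfl fun i _ => ?_
          rw [tele i, sum_mul]
          refine sum_congr rfl fun k _ => ?_
          split_ifs <;> simp
      _ = _ := by
          rw [sum_comm]
          simp_rw [mul_sum]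
          rfl
  · rw [← Equiv.sum_comp e, ← Fin.sum_univ_eq_sum_range (fun k => y k ^ 2)]
    simp_rw [hy]

lemma sq_sqrt_succ_sub_sqrt_le (k : ℕ) (hk : 0 < k) :
    (√((k + 1 : ℕ) : ℝ) - √(k : ℝ)) ^ 2 ≤
      1 / 4 * (Real.log ((k + 1 : ℕ) : ℝ) - Real.log (k : ℝ)) := by
  have hk0 : (0 : ℝ) < k := by exact_mod_cast hk
  set a := √((k + 1 : ℕ) : ℝ) with ha
  set b := √(k : ℝ) with hb
  have ha2 : a ^ 2 = k + 1 := by rw [ha, Real.sq_sqrt (by positivity)]; push_cast; rfl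
  have hb2 : b ^ 2 = k := Real.sq_sqrt hk0.le
  have hb0 : 0 < b := Real.sqrt_pos.2 hk0
  have ha0 : 0 < a := Real.sqrt_pos.2 (by positivity)
  have hab : b ≤ a := Real.sqrt_le_sqrt (by push_cast; linarith)
  have hlog := Real.le_log_one_add_of_nonneg (x := (a - b) / b)
    (div_nonneg (sub_nonneg.2 hab) hb0.le)
  have h1 : 1 + (a - b) / b = a / b := by field_simp; ring
  have h2 : 2 * ((a - b) / b) / ((a - b) / b + 2) = 2 * (a - b) ^ 2 := by
    have h3 : (a - b) / b + 2 = (a + b) / b := by field_simp; ring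
    rw [h3]
    field_simp
    nlinarith
  rw [h1, h2, Real.log_div ha0.ne' hb0.ne'] at hlog
  have e1 : Real.log ((k + 1 : ℕ) : ℝ) = 2 * Real.log a := by
    rw [ha, Real.log_sqrt (by positivity)]; ring
  have e2 : Real.log (k : ℝ) = 2 * Real.log b := by
    rw [hb, Real.log_sqrt hk0.le]; ring
  rw [e1, e2]
  linarith

lemma sum_sq_sqrt_succ_sub_sqrt_le (n : ℕ) (hn : 1 ≤ n) :
    ∑ k ∈ Finset.range n, (√((k + 1 : ℕ) : ℝ) - √(k : ℝ)) ^ 2 ≤ 1 / 4 * Real.log n + 1 := by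
  induction n, hn using Nat.le_induction with
  | base => simp
  | succ m hm ih =>
    rw [Finset.sum_range_succ]
    have := sq_sqrt_succ_sub_sqrt_le m hm
    linarith

lemma sum_sub_succ_mul_sqrt (y : ℕ → ℝ) (n : ℕ) :
    ∑ k ∈ Finset.range n, (y k - y (k + 1)) * √((k + 1 : ℕ) : ℝ) =
      ∑ k ∈ Finset.range n, y k * (√((k + 1 : ℕ) : ℝ) - √(k : ℝ)) - y n * √(n : ℝ) := by
  induction n with
  | zero => simp
  | succ m ih => rw [Finset.sum_range_succ, Finset.sum_range_succ, ih]; ring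

open Finset in
lemma quadratic_form_le_of_cut_bound {V : Type*} [Fintype V] (hV : 1 ≤ Fintype.card V)
    (A : V → V → ℝ) (M : ℝ) (hM : 0 ≤ M)
    (h : ∀ X Y : Finset V, X.Nonempty → Y.Nonempty →
      ∑ i ∈ X, ∑ j ∈ Y, A i j ≤ M * (√(X.card : ℝ) * √(Y.card : ℝ)))
    (x : V → ℝ) (hx : ∀ v, 0 ≤ x v) :
    ∑ i, x i * ∑ j, x j * A i j ≤
      (1 / 4 * Real.log (Fintype.card V) + 1) * M * ∑ i, x i ^ 2 := by
  obtain ⟨y, S, hyn, hc, hS, hdec, hsq⟩ := exists_layer_decomposition x hx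
  set n := Fintype.card V
  set c : ℕ → ℝ := fun k => y k - y (k + 1)
  set r : ℕ → ℝ := fun k => √((k + 1 : ℕ) : ℝ)
  have hne : ∀ k, k < n → (S k).Nonempty := fun k hk => card_pos.1 (by rw [hS k hk]; simp)
  have hsum : ∑ k ∈ range n, c k * r k =
      ∑ k ∈ range n, y k * (√((k + 1 : ℕ) : ℝ) - √(k : ℝ)) := by
    rw [sum_sub_succ_mul_sqrt, hyn]; simp
  calc ∑ i, x i * ∑ j, x j * A i j
      = ∑ k ∈ range n, ∑ l ∈ range n, c k * c l * ∑ i ∈ S k, ∑ j ∈ S l, A i j := by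
        rw [hdec]
        refine sum_congr rfl fun k _ => ?_
        simp_rw [hdec]
        rw [sum_comm, mul_sum]
        refine sum_congr rfl fun l _ => ?_
        rw [← mul_sum, mul_assoc]
    _ ≤ ∑ k ∈ range n, ∑ l ∈ range n, c k * c l * (M * (r k * r l)) := by
        refine sum_le_sum fun k hk => sum_le_sum fun l hl => ?_
        rw [mem_range] at hk hl
        have := h (S k) (S l) (hne k hk) (hne l hl)
        rw [hS k hk, hS l hl] at this
        exact mul_le_mul_of_nonneg_left this (mul_nonneg (hc k hk) (hc l hl))
    _ = M * (∑ k ∈ range n, c k * r k) ^ 2 := by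
        rw [sq, sum_mul_sum, mul_sum]
        refine sum_congr rfl fun k _ => ?_
        rw [mul_sum]
        exact sum_congr rfl fun l _ => by ring
    _ ≤ M * ((∑ k ∈ range n, y k ^ 2) *
          ∑ k ∈ range n, (√((k + 1 : ℕ) : ℝ) - √(k : ℝ)) ^ 2) := by
        rw [hsum]
        exact mul_le_mul_of_nonneg_left (sum_mul_sq_le_sq_mul_sq _ _ _) hM
    _ ≤ M * ((∑ i, x i ^ 2) * (1 / 4 * Real.log n + 1)) := by
        rw [hsq]
        exact mul_le_mul_of_nonneg_left (mul_le_mul_of_nonneg_left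
          (sum_sq_sqrt_succ_sub_sqrt_le n hV) (sum_nonneg fun i _ => sq_nonneg _)) hM
    _ = _ := by ring

lemma quadratic_form_abs_le {V : Type*} [Fintype V] (A : V → V → ℝ)
    (hA : ∀ i j, 0 ≤ A i j) (x : V → ℝ) :
    |∑ i, x i * ∑ j, x j * A i j| ≤ ∑ i, |x i| * ∑ j, |x j| * A i j := by
  refine (Finset.abs_sum_le_sum_abs _ _).trans (Finset.sum_le_sum fun i _ => ?_)
  rw [abs_mul]
  refine mul_le_mul_of_nonneg_left ?_ (abs_nonneg _)
  refine (Finset.abs_sum_le_sum_abs _ _).trans (Finset.sum_le_sum fun j _ => ?_)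
  rw [abs_mul, abs_of_nonneg (hA i j)]

lemma dotProduct_mulVec_eq_sum {V : Type*} [Fintype V] (A : Matrix V V ℝ) (x : V → ℝ) :
    x ⬝ᵥ (A.mulVec x) = ∑ i, x i * ∑ j, x j * A i j := by
  simp only [dotProduct, Matrix.mulVec, mul_comm]

lemma quadratic_form_le_sSup_spectrum {V : Type*} [Fintype V] [DecidableEq V]
    (A : Matrix V V ℝ) (hA : A.IsHermitian) (x : V → ℝ) :
    ∑ i, x i * ∑ j, x j * A i j ≤ sSup (spectrum ℝ A) * ∑ i, x i ^ 2 := by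
  have hpos : (algebraMap ℝ (Matrix V V ℝ) (sSup (spectrum ℝ A)) - A).PosSemidef := by
    rw [Matrix.posSemidef_iff_isHermitian_and_spectrum_nonneg]
    refine ⟨Matrix.IsHermitian.sub ?_ hA, ?_⟩
    · rw [Matrix.algebraMap_eq_diagonal]
      exact Matrix.isHermitian_diagonal _
    · rw [← spectrum.singleton_sub_eq]
      rintro _ ⟨_, rfl, m, hm, rfl⟩
      exact sub_nonneg.2 (le_csSup (Matrix.finite_real_spectrum).bddAbove hm)
  have := hpos.dotProduct_mulVec_nonneg x
  rw [Matrix.sub_mulVec, Algebra.algebraMap_eq_smul_one, Matrix.smul_mulVec, Matrix.one_mulVec,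
    dotProduct_sub, star_trivial, dotProduct_mulVec_eq_sum, dotProduct_smul, smul_eq_mul] at this
  have e : x ⬝ᵥ x = ∑ i, x i ^ 2 := by simp [dotProduct, sq]
  rw [e] at this
  linarith

lemma bilinear_form_le_of_quadratic_form_le {V : Type*} [Fintype V] (A : V → V → ℝ)
    (hA : ∀ i j, 0 ≤ A i j) (hsymm : ∀ i j, A i j = A j i) (L : ℝ)
    (hL : ∀ x : V → ℝ, ∑ i, x i * ∑ j, x j * A i j ≤ L * ∑ i, x i ^ 2) (x y : V → ℝ) :
    2 * ∑ i, x i * ∑ j, y j * A i j ≤ L * (∑ i, x i ^ 2 + ∑ i, y i ^ 2) := by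
  have h1 := hL fun i => x i + y i
  have h2 := (neg_le_abs _).trans ((quadratic_form_abs_le A hA fun i => x i - y i).trans (hL _))
  have hs : ∑ i, y i * ∑ j, x j * A i j = ∑ i, x i * ∑ j, y j * A i j := by
    simp_rw [Finset.mul_sum]
    rw [Finset.sum_comm]
    refine Finset.sum_congr rfl fun i _ => Finset.sum_congr rfl fun j _ => ?_
    rw [hsymm i j]; ring
  simp only [sq_abs, add_mul, sub_mul, mul_add, mul_sub, add_sq, sub_sq, Finset.sum_add_distrib,
    Finset.sum_sub_distrib, hs] at h1 h2
  linarith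

open Classical in
lemma eXY_eq_sum {V : Type*} [Fintype V] (G : SimpleGraph V) (X Y : Finset V) :
    (eXY G X Y : ℝ) = ∑ i ∈ X, ∑ j ∈ Y, G.adjMatrix ℝ i j := by
  simp only [eXY, Finset.card_filter, Nat.cast_sum, Finset.sum_product, SimpleGraph.adjMatrix_apply]
  simp

lemma le_MG {V : Type*} [Fintype V] (G : SimpleGraph V) (X Y : Finset V)
    (hX : X.Nonempty) (hY : Y.Nonempty) :
    (eXY G X Y : ℝ) / √((X.card : ℝ) * (Y.card : ℝ)) ≤ MG G := by
  refine le_csSup (Set.Finite.bddAbove ?_) ⟨X, Y, hX, hY, rfl⟩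
  refine (Set.finite_range fun p : Finset V × Finset V =>
    (eXY G p.1 p.2 : ℝ) / √((p.1.card : ℝ) * (p.2.card : ℝ))).subset ?_
  rintro _ ⟨X, Y, -, -, rfl⟩
  exact ⟨(X, Y), rfl⟩

/-- Theorem 1: `M(G) ≤ λmax(G) ≤ ((1/4)·log|V| + 1)·M(G)`. -/
theorem statement0 {V : Type*} [Fintype V] (G : SimpleGraph V)
    (hV : 1 ≤ Fintype.card V) :
    MG G ≤ lamMax G ∧
      lamMax G ≤ ((1 / 4 : ℝ) * Real.log (Fintype.card V) + 1) * MG G := by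
  classical
  have hne : Nonempty V := Fintype.card_pos_iff.1 hV
  have hdef : lamMax G = sSup (spectrum ℝ (G.adjMatrix ℝ)) := by
    unfold lamMax; congr!
  set A := G.adjMatrix ℝ with hAdef
  have hsymm : ∀ i j, A i j = A j i := fun i j => G.isSymm_adjMatrix.apply j i
  have hA : A.IsHermitian := Matrix.IsHermitian.ext fun i j => by simp [hsymm i j]
  have hA0 : ∀ i j, 0 ≤ A i j := fun i j => by
    rw [hAdef, SimpleGraph.adjMatrix_apply]; split_ifs <;> simp
  have hE : ∀ X Y : Finset V, (eXY G X Y : ℝ) = ∑ i ∈ X, ∑ j ∈ Y, A i j := fun X Y =>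
    eXY_eq_sum G X Y
  constructor
  · rw [hdef]
    refine csSup_le ⟨_, Finset.univ, Finset.univ, Finset.univ_nonempty, Finset.univ_nonempty, rfl⟩ ?_
    rintro _ ⟨X, Y, hX, hY, rfl⟩
    have ha : (0 : ℝ) < X.card := by exact_mod_cast hX.card_pos
    have hb : (0 : ℝ) < Y.card := by exact_mod_cast hY.card_pos
    have key := bilinear_form_le_of_quadratic_form_le A hA0 hsymm _
      (quadratic_form_le_sSup_spectrum A hA)
      (fun i => if i ∈ X then √(Y.card : ℝ) else 0) (fun i => if i ∈ Y then √(X.card : ℝ) else 0)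
    simp only [ite_mul, zero_mul, Finset.sum_ite_mem, Finset.univ_inter, ← Finset.mul_sum,
      ite_pow, Real.sq_sqrt ha.le, Real.sq_sqrt hb.le, ne_eq, OfNat.ofNat_ne_zero,
      not_false_eq_true, zero_pow, Finset.sum_const, nsmul_eq_mul, ← hE] at key
    have hs : √((X.card : ℝ) * Y.card) = √(X.card : ℝ) * √(Y.card : ℝ) := Real.sqrt_mul ha.le _
    have hs2 : √((X.card : ℝ) * Y.card) * √((X.card : ℝ) * Y.card) = X.card * Y.card :=
      Real.mul_self_sqrt (by positivity)
    have hs0 : 0 < √((X.card : ℝ) * Y.card) := Real.sqrt_pos.2 (by positivity)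
    rw [div_le_iff₀ hs0]
    refine le_of_mul_le_mul_left ?_ hs0
    have e1 : √((X.card : ℝ) * Y.card) * (sSup (spectrum ℝ A) * √((X.card : ℝ) * Y.card)) =
        sSup (spectrum ℝ A) * (X.card * Y.card) := by
      rw [mul_left_comm, hs2]
    rw [e1, hs]
    linarith
  · have hM : 0 ≤ MG G := le_trans (by positivity)
      (le_MG G Finset.univ Finset.univ Finset.univ_nonempty Finset.univ_nonempty)
    rw [hdef]
    refine csSup_le (hA.spectrum_real_eq_range_eigenvalues ▸ Set.range_nonempty _) fun m hm => ?_
    rw [← Matrix.spectrum_toLin', ← Module.End.hasEigenvalue_iff_mem_spectrum] at hm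
    obtain ⟨z, hz⟩ := hm.exists_hasEigenvector
    have hz1 : A.mulVec z = m • z := by simpa using hz.apply_eq_smul
    have hz2 : ∑ i, z i * ∑ j, z j * A i j = m * ∑ i, z i ^ 2 := by
      rw [← dotProduct_mulVec_eq_sum, hz1, dotProduct_smul, smul_eq_mul]
      simp [dotProduct, sq]
    have hzpos : 0 < ∑ i, z i ^ 2 := by
      obtain ⟨i, hi⟩ := Function.ne_iff.1 hz.2
      exact Finset.sum_pos' (fun i _ => sq_nonneg _) ⟨i, Finset.mem_univ _, by
        have : z i ≠ 0 := hi
        positivity⟩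
    have hcut : ∀ X Y : Finset V, X.Nonempty → Y.Nonempty →
        ∑ i ∈ X, ∑ j ∈ Y, A i j ≤ MG G * (√(X.card : ℝ) * √(Y.card : ℝ)) := by
      intro X Y hX hY
      have ha : (0 : ℝ) < X.card := by exact_mod_cast hX.card_pos
      have hb : (0 : ℝ) < Y.card := by exact_mod_cast hY.card_pos
      have := le_MG G X Y hX hY
      rwa [div_le_iff₀ (Real.sqrt_pos.2 (by positivity)), Real.sqrt_mul ha.le, hE] at this
    have key := quadratic_form_le_of_cut_bound hV A _ hM hcut (fun i => |z i|)
      fun i => abs_nonneg _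
    have := (le_abs_self _).trans ((quadratic_form_abs_le A hA0 z).trans key)
    simp only [sq_abs] at this
    rw [hz2] at this
    exact le_of_mul_le_mul_right this hzpos
end

section
/- Let G be a finite simple graph with vertex set V having at least one edge, and let Δ(G) be the maximum degree of G. Then M(G) ≤ λmax(G) ≤ √((log Δ(G) + 1)·((1/4)·log|V| + 1))·M(G). -/
open Finset Matrix in
/-- The quadratic form of a real symmetric matrix is bounded by its largest eigenvalue. -/
lemma Matrix.IsHermitian.dotProduct_mulVec_le_sSup_spectrum {n : Type*} [Fintype n] [DecidableEq n]
    {A : Matrix n n ℝ} (hA : A.IsHermitian) (v : n → ℝ) :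
    v ⬝ᵥ A *ᵥ v ≤ sSup (spectrum ℝ A) * (v ⬝ᵥ v) := by
  set l := sSup (spectrum ℝ A)
  have hB : (algebraMap ℝ (Matrix n n ℝ) l - A).IsHermitian := by
    refine Matrix.IsHermitian.sub ?_ hA
    rw [Matrix.algebraMap_eq_diagonal]
    exact Matrix.isHermitian_diagonal _
  have hpos : (algebraMap ℝ (Matrix n n ℝ) l - A).PosSemidef := by
    rw [hB.posSemidef_iff_eigenvalues_nonneg]
    intro i
    have hi : hB.eigenvalues i ∈ spectrum ℝ (algebraMap ℝ (Matrix n n ℝ) l - A) := by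
      rw [hB.spectrum_real_eq_range_eigenvalues]
      exact ⟨i, rfl⟩
    rw [← spectrum.singleton_sub_eq] at hi
    obtain ⟨_, rfl, m, hm, h⟩ := Set.mem_sub.1 hi
    have := le_csSup A.finite_real_spectrum.bddAbove hm
    change 0 ≤ hB.eigenvalues i
    linarith
  have := hpos.dotProduct_mulVec_nonneg v
  rw [Matrix.sub_mulVec, dotProduct_sub, Algebra.algebraMap_eq_smul_one, Matrix.smul_mulVec,
    Matrix.one_mulVec, dotProduct_smul] at this
  simpa using this

/-- Summation by parts, expressing a weighted sum through the partial sums. -/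
lemma sum_range_smul_eq_sum_partialSums {F : Type*} [AddCommGroup F] [Module ℝ F]
    (a : ℕ → ℝ) (u : ℕ → F) (m : ℕ) :
    ∑ i ∈ Finset.range m, a i • u i =
      ∑ i ∈ Finset.range m, (a i - a (i + 1)) • ∑ j ∈ Finset.range (i + 1), u j +
        a m • ∑ j ∈ Finset.range m, u j := by
  induction m with
  | zero => simp
  | succ m ih =>
    rw [Finset.sum_range_succ, ih, Finset.sum_range_succ _ m, sub_smul,
      Finset.sum_range_succ u m, smul_add]
    abel

/-- Bounds on the norms of the partial sums of `w` by the partial sums of `b` transfer to sums with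
nonnegative antitone weights. -/
lemma norm_sum_smul_le_of_antitone {E : Type*} [NormedAddCommGroup E] [NormedSpace ℝ E] {w : ℕ → E}
    {a b : ℕ → ℝ} (ha : Antitone a) (ha0 : ∀ i, 0 ≤ a i) {n : ℕ}
    (h : ∀ m ≤ n, ‖∑ i ∈ Finset.range m, w i‖ ≤ ∑ i ∈ Finset.range m, b i) :
    ‖∑ i ∈ Finset.range n, a i • w i‖ ≤ ∑ i ∈ Finset.range n, a i * b i := by
  have hb := sum_range_smul_eq_sum_partialSums a b n
  simp only [smul_eq_mul] at hb
  rw [sum_range_smul_eq_sum_partialSums, hb]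
  refine (norm_add_le _ _).trans (add_le_add ((norm_sum_le _ _).trans ?_) ?_)
  · refine Finset.sum_le_sum fun i hi => ?_
    have hi' : 0 ≤ a i - a (i + 1) := sub_nonneg.2 (ha i.le_succ)
    rw [norm_smul, Real.norm_of_nonneg hi']
    exact mul_le_mul_of_nonneg_left (h _ (Finset.mem_range.1 hi)) hi'
  · rw [norm_smul, Real.norm_of_nonneg (ha0 n)]
    exact mul_le_mul_of_nonneg_left (h n le_rfl) (ha0 n)

/-- The increments of the square root have square sum at most `1 + log n / 4`. -/
lemma sum_sqrt_succ_sub_sqrt_sq_le {n : ℕ} (hn : 1 ≤ n) :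
    ∑ i ∈ Finset.range n, (√((i : ℝ) + 1) - √(i : ℝ)) ^ 2 ≤ 1 / 4 * Real.log n + 1 := by
  induction n, hn using Nat.le_induction with
  | base => simp
  | succ n hn ih =>
    rw [Finset.sum_range_succ]
    have hn0 : (0 : ℝ) < n := by exact_mod_cast hn
    have hp : 0 < √(n : ℝ) := Real.sqrt_pos.2 hn0
    have hpq : √(n : ℝ) ≤ √((n : ℝ) + 1) := Real.sqrt_le_sqrt (by linarith)
    have hp2 : √(n : ℝ) ^ 2 = n := Real.sq_sqrt hn0.le
    have hq2 : √((n : ℝ) + 1) ^ 2 = n + 1 := Real.sq_sqrt (by linarith)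
    have hlp : Real.log √(n : ℝ) = Real.log n / 2 := Real.log_sqrt hn0.le
    have hlq : Real.log √((n : ℝ) + 1) = Real.log (n + 1) / 2 := Real.log_sqrt (by linarith)
    set p := √(n : ℝ)
    set q := √((n : ℝ) + 1)
    have hlog := Real.le_log_one_add_of_nonneg (x := (q - p) / p)
      (div_nonneg (by linarith) hp.le)
    have h1 : 1 + (q - p) / p = q / p := by field_simp; ring
    have h2 : 2 * ((q - p) / p) / ((q - p) / p + 2) = 2 * (q - p) ^ 2 := by
      have : (q - p) * (q + p) = 1 := by linear_combination hq2 - hp2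
      have h3 : (q - p) / p + 2 = (q + p) / p := by field_simp; ring
      have h4 : q + p ≠ 0 := by positivity
      rw [h3]
      field_simp
      linear_combination (-(q - p)) * this
    rw [h1, h2, Real.log_div (by linarith) hp.ne', hlp, hlq] at hlog
    push_cast
    linarith

open Finset in
/-- If all partial sums of `h : V → ℕ` satisfy `(∑ x ∈ X, h x) ^ 2 ≤ c * #X` and `h ≤ D`, then
`∑ h ^ 2` is at most `c * (log D + 1)`. -/
lemma sum_sq_le_of_sum_sq_le_card {V : Type*} [Fintype V] (h : V → ℕ) {D : ℕ} (hD : ∀ x, h x ≤ D)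
    {c : ℝ} (hc0 : 0 ≤ c) (hc : ∀ X : Finset V, (∑ x ∈ X, (h x : ℝ)) ^ 2 ≤ c * #X) :
    ∑ x, (h x : ℝ) ^ 2 ≤ c * (Real.log D + 1) := by
  have e1 : ∑ x, (h x : ℝ) ^ 2 =
      ∑ k ∈ range D, ∑ x with k + 1 ≤ h x, (h x : ℝ) := by
    simp_rw [sum_filter]
    rw [sum_comm]
    refine sum_congr rfl fun x _ => ?_
    rw [← sum_filter, sum_const, nsmul_eq_mul, sq]
    congr 2
    have : (range D).filter (fun k => k + 1 ≤ h x) = range (h x) := by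
      ext k
      have := hD x
      simp only [mem_filter, mem_range]
      omega
    rw [this, card_range]
  have e2 : ∀ k ∈ range D, ∑ x with k + 1 ≤ h x, (h x : ℝ) ≤ c * ((k : ℝ) + 1)⁻¹ := by
    intro k _
    set X : Finset V := {x | k + 1 ≤ h x}
    have h1 : ((k : ℝ) + 1) * #X ≤ ∑ x ∈ X, (h x : ℝ) := by
      have : ∑ x ∈ X, ((k : ℝ) + 1) ≤ ∑ x ∈ X, (h x : ℝ) := by
        refine sum_le_sum fun x hx => ?_
        exact_mod_cast (mem_filter.1 hx).2
      rwa [sum_const, nsmul_eq_mul, mul_comm] at this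
    have h2 := hc X
    set S := ∑ x ∈ X, (h x : ℝ)
    have hk : (0 : ℝ) < (k : ℝ) + 1 := by positivity
    rw [← div_eq_mul_inv, le_div_iff₀ hk]
    rcases (show 0 ≤ S by positivity).eq_or_lt with h0 | h0
    · rw [← h0]; simpa using hc0
    · refine le_of_mul_le_mul_right ?_ h0
      nlinarith [mul_le_mul_of_nonneg_left h1 hc0]
  rw [e1]
  refine (sum_le_sum e2).trans ?_
  rw [← mul_sum]
  refine mul_le_mul_of_nonneg_left ?_ hc0
  have := harmonic_le_one_add_log D
  rw [harmonic] at this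
  push_cast at this
  linarith

open Finset in
/-- A linear map bounded by `C * √#Y` on indicators of finite sets `Y` is bounded in the Euclidean
norm on nonnegative vectors, up to a logarithmic loss in the dimension. -/
lemma norm_sq_map_le_of_indicator {V E : Type*} [Fintype V] [Nonempty V] [DecidableEq V]
    [NormedAddCommGroup E] [NormedSpace ℝ E] (T : (V → ℝ) →ₗ[ℝ] E) {C : ℝ}
    (hT : ∀ Y : Finset V, ‖T (∑ y ∈ Y, Pi.single y 1)‖ ≤ C * √(#Y : ℝ))
    {g : V → ℝ} (hg : ∀ x, 0 ≤ g x) :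
    ‖T g‖ ^ 2 ≤ C ^ 2 * (1 / 4 * Real.log (Fintype.card V) + 1) * ∑ x, g x ^ 2 := by
  obtain ⟨n, hn⟩ : ∃ n, n = Fintype.card V := ⟨_, rfl⟩
  obtain ⟨τ, hτ⟩ : ∃ τ : Fin n ≃ V, Antitone (g ∘ τ) := by
    let e : V ≃ Fin n := Fintype.equivFinOfCardEq hn.symm
    refine ⟨(Tuple.sort fun i => -g (e.symm i)).trans e.symm, fun i j hij => ?_⟩
    have := Tuple.monotone_sort (fun i => -g (e.symm i)) hij
    simpa using this
  let a : ℕ → ℝ := fun i => if h : i < n then g (τ ⟨i, h⟩) else 0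
  let w : ℕ → E := fun i => if h : i < n then T (Pi.single (τ ⟨i, h⟩) 1) else 0
  let b : ℕ → ℝ := fun i => √((i : ℝ) + 1) - √(i : ℝ)
  have ha0 : ∀ i, 0 ≤ a i := by
    intro i
    simp only [a]
    split_ifs
    · exact hg _
    · exact le_rfl
  have ha : Antitone a := by
    intro i j hij
    by_cases hj : j < n
    · have hi : i < n := hij.trans_lt hj
      simp only [a, hi, hj, dif_pos]
      exact hτ (show (⟨i, hi⟩ : Fin n) ≤ ⟨j, hj⟩ from hij)
    · have : a j = 0 := by simp [a, hj]
      rw [this]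
      exact ha0 i
  have hsum : ∑ i ∈ range n, a i • w i = T g := by
    rw [Finset.sum_range]
    simp only [a, w, Fin.is_lt, dif_pos, Fin.eta]
    rw [Equiv.sum_comp τ fun x => g x • T (Pi.single x 1)]
    simp_rw [← map_smul, ← map_sum]
    congr 1
    ext x
    simp [Finset.sum_apply, Pi.single_apply]
  have hpart : ∀ m ≤ n, ‖∑ i ∈ range m, w i‖ ≤ ∑ i ∈ range m, C * b i := by
    intro m hm
    have hw : ∑ i ∈ range m, w i =
        T (∑ y ∈ univ.map ((Fin.castLEEmb hm).trans τ.toEmbedding), Pi.single y 1) := by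
      rw [sum_map, map_sum, Finset.sum_range]
      refine sum_congr rfl fun i _ => ?_
      have : (i : ℕ) < n := i.2.trans_le hm
      simp only [w, this, dif_pos]
      rfl
    have hb : ∑ i ∈ range m, b i = √(m : ℝ) := by
      have := sum_range_sub (fun i : ℕ => √(i : ℝ)) m
      simpa [b] using this
    rw [hw, ← mul_sum, hb]
    simpa using hT (univ.map ((Fin.castLEEmb hm).trans τ.toEmbedding))
  have key := norm_sum_smul_le_of_antitone ha ha0 hpart
  have hsq : ∑ i ∈ range n, a i ^ 2 = ∑ x, g x ^ 2 := by
    rw [Finset.sum_range]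
    simp only [a, Fin.is_lt, dif_pos, Fin.eta]
    exact Equiv.sum_comp τ fun x => g x ^ 2
  have hcs := sum_mul_sq_le_sq_mul_sq (range n) a b
  have hb := sum_sqrt_succ_sub_sqrt_sq_le (n := n) (hn ▸ Fintype.card_pos)
  rw [hsum] at key
  rw [← hn]
  calc ‖T g‖ ^ 2 ≤ (∑ i ∈ range n, a i * (C * b i)) ^ 2 := by gcongr
    _ = C ^ 2 * (∑ i ∈ range n, a i * b i) ^ 2 := by
      rw [← mul_pow, mul_sum]
      congr 1
      exact sum_congr rfl fun i _ => by ring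
    _ ≤ C ^ 2 * ((∑ i ∈ range n, a i ^ 2) * (1 / 4 * Real.log n + 1)) := by
      refine mul_le_mul_of_nonneg_left (hcs.trans ?_) (sq_nonneg C)
      exact mul_le_mul_of_nonneg_left hb (sum_nonneg fun i _ => sq_nonneg _)
    _ = _ := by rw [hsq]; ring

lemma bddAbove_eXY_div_sqrt {V : Type*} [Fintype V] (G : SimpleGraph V) :
    BddAbove {r : ℝ | ∃ X Y : Finset V, X.Nonempty ∧ Y.Nonempty ∧
      r = (eXY G X Y : ℝ) / Real.sqrt ((X.card : ℝ) * (Y.card : ℝ))} := by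
  refine ((Set.finite_range fun p : Finset V × Finset V =>
    (eXY G p.1 p.2 : ℝ) / Real.sqrt ((p.1.card : ℝ) * (p.2.card : ℝ))).subset ?_).bddAbove
  rintro r ⟨X, Y, -, -, rfl⟩
  exact ⟨(X, Y), rfl⟩

lemma MG_nonneg {V : Type*} (G : SimpleGraph V) : 0 ≤ MG G := by
  refine Real.sSup_nonneg ?_
  rintro r ⟨X, Y, -, -, rfl⟩
  positivity

lemma eXY_sq_le {V : Type*} [Fintype V] (G : SimpleGraph V) (X Y : Finset V) :
    (eXY G X Y : ℝ) ^ 2 ≤ MG G ^ 2 * Y.card * X.card := by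
  rcases X.eq_empty_or_nonempty with rfl | hX
  · simp [eXY]
  rcases Y.eq_empty_or_nonempty with rfl | hY
  · simp [eXY]
  have h := le_csSup (bddAbove_eXY_div_sqrt G) ⟨X, Y, hX, hY, rfl⟩
  have hX' : (0 : ℝ) < X.card := by exact_mod_cast hX.card_pos
  have hY' : (0 : ℝ) < Y.card := by exact_mod_cast hY.card_pos
  rw [div_le_iff₀ (by positivity)] at h
  calc (eXY G X Y : ℝ) ^ 2 ≤ (MG G * √((X.card : ℝ) * (Y.card : ℝ))) ^ 2 := by
        gcongr
        exact h
    _ = _ := by rw [mul_pow, Real.sq_sqrt (by positivity)]; ring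

open Classical Matrix in
lemma adjMatrix_mulVec_sum_single {V : Type*} [Fintype V] (G : SimpleGraph V) (Y : Finset V)
    (x : V) : (G.adjMatrix ℝ *ᵥ ∑ y ∈ Y, Pi.single y 1) x = (Y.filter (G.Adj x)).card := by
  rw [Matrix.mulVec_sum, Finset.sum_apply]
  simp

open Classical in
lemma sum_card_filter_adj_eq_eXY {V : Type*} (G : SimpleGraph V) (X Y : Finset V) :
    ∑ x ∈ X, (Y.filter (G.Adj x)).card = eXY G X Y := by
  simp only [eXY, Finset.card_filter, Finset.sum_product]

open Classical Matrix in
/-- The quadratic form of the adjacency matrix grows when taking absolute values. -/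
lemma neg_dotProduct_adjMatrix_mulVec_le {V : Type*} [Fintype V] (G : SimpleGraph V) (v : V → ℝ) :
    -(v ⬝ᵥ G.adjMatrix ℝ *ᵥ v) ≤ |v| ⬝ᵥ G.adjMatrix ℝ *ᵥ |v| := by
  simp only [dotProduct, SimpleGraph.adjMatrix_mulVec_apply, Finset.mul_sum,
    ← Finset.sum_neg_distrib, Pi.abs_apply]
  refine Finset.sum_le_sum fun x _ => Finset.sum_le_sum fun y _ => ?_
  rw [← abs_mul]
  exact neg_le_abs _

open Classical Matrix in
/-- The bilinear form of the adjacency matrix is bounded by its largest eigenvalue. -/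
lemma two_mul_dotProduct_adjMatrix_mulVec_le {V : Type*} [Fintype V] (G : SimpleGraph V)
    (u v : V → ℝ) :
    2 * (u ⬝ᵥ G.adjMatrix ℝ *ᵥ v) ≤ lamMax G * (u ⬝ᵥ u + v ⬝ᵥ v) := by
  have hA := G.isHermitian_adjMatrix ℝ
  have h1 := hA.dotProduct_mulVec_le_sSup_spectrum (u + v)
  have h2 := (neg_dotProduct_adjMatrix_mulVec_le G (u - v)).trans
    (hA.dotProduct_mulVec_le_sSup_spectrum |u - v|)
  have habs : |u - v| ⬝ᵥ |u - v| = (u - v) ⬝ᵥ (u - v) := by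
    simp [dotProduct, abs_mul_abs_self]
  have hsymm : v ⬝ᵥ G.adjMatrix ℝ *ᵥ u = u ⬝ᵥ G.adjMatrix ℝ *ᵥ v := by
    rw [dotProduct_mulVec, ← mulVec_transpose, G.isSymm_adjMatrix.eq, dotProduct_comm]
  rw [habs] at h2
  change _ ≤ lamMax G * _ at h1 h2
  simp only [mulVec_add, mulVec_sub, add_dotProduct, sub_dotProduct, dotProduct_add,
    dotProduct_sub, hsymm, dotProduct_comm v u] at h1 h2
  linarith

open Classical Matrix in
lemma eXY_div_sqrt_le_lamMax {V : Type*} [Fintype V] (G : SimpleGraph V) {X Y : Finset V}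
    (hX : X.Nonempty) (hY : Y.Nonempty) :
    (eXY G X Y : ℝ) / √((X.card : ℝ) * (Y.card : ℝ)) ≤ lamMax G := by
  have hX' : (0 : ℝ) < √(X.card : ℝ) := Real.sqrt_pos.2 (by exact_mod_cast hX.card_pos)
  have hY' : (0 : ℝ) < √(Y.card : ℝ) := Real.sqrt_pos.2 (by exact_mod_cast hY.card_pos)
  have hind : ∀ Z : Finset V,
      (∑ z ∈ Z, Pi.single z (1 : ℝ) : V → ℝ) = fun x => if x ∈ Z then 1 else 0 := by
    intro Z
    ext x
    simp [Finset.sum_apply, Pi.single_apply]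
  have hself : ∀ Z : Finset V, (∑ z ∈ Z, Pi.single z (1 : ℝ) : V → ℝ) ⬝ᵥ
      (∑ z ∈ Z, Pi.single z (1 : ℝ)) = √(Z.card : ℝ) ^ 2 := by
    intro Z
    rw [hind, Real.sq_sqrt (Nat.cast_nonneg _)]
    simp [dotProduct]
  have he : (∑ z ∈ X, Pi.single z (1 : ℝ) : V → ℝ) ⬝ᵥ
      G.adjMatrix ℝ *ᵥ (∑ z ∈ Y, Pi.single z (1 : ℝ)) = eXY G X Y := by
    rw [← sum_card_filter_adj_eq_eXY, hind X]
    simp only [dotProduct, adjMatrix_mulVec_sum_single]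
    simp
  have key := two_mul_dotProduct_adjMatrix_mulVec_le G
    ((√(X.card : ℝ))⁻¹ • ∑ z ∈ X, Pi.single z (1 : ℝ))
    ((√(Y.card : ℝ))⁻¹ • ∑ z ∈ Y, Pi.single z (1 : ℝ))
  simp only [mulVec_smul, smul_dotProduct, dotProduct_smul, hself, he, smul_eq_mul] at key
  rw [Real.sqrt_mul (Nat.cast_nonneg _), div_eq_mul_inv, mul_inv]
  have hx : (√(X.card : ℝ))⁻¹ * ((√(X.card : ℝ))⁻¹ * √(X.card : ℝ) ^ 2) = 1 := by field_simp
  have hy : (√(Y.card : ℝ))⁻¹ * ((√(Y.card : ℝ))⁻¹ * √(Y.card : ℝ) ^ 2) = 1 := by field_simp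
  rw [hx, hy] at key
  linarith

open Classical Matrix in
lemma exists_adjMatrix_mulVec_eq_lamMax_smul {V : Type*} [Fintype V] [Nonempty V]
    (G : SimpleGraph V) : ∃ u : V → ℝ, u ≠ 0 ∧ G.adjMatrix ℝ *ᵥ u = lamMax G • u := by
  have hA := G.isHermitian_adjMatrix ℝ
  have hmem : lamMax G ∈ spectrum ℝ (G.adjMatrix ℝ) := by
    refine Set.Nonempty.csSup_mem ?_ (Matrix.finite_real_spectrum (A := G.adjMatrix ℝ))
    rw [hA.spectrum_real_eq_range_eigenvalues]
    exact Set.range_nonempty _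
  rw [← Matrix.spectrum_toLin', ← Module.End.hasEigenvalue_iff_mem_spectrum] at hmem
  obtain ⟨u, hu⟩ := hmem.exists_hasEigenvector
  exact ⟨u, hu.2, by simpa using hu.apply_eq_smul⟩

open Classical Matrix in
lemma sum_sq_adjMatrix_mulVec_indicator_le {V : Type*} [Fintype V] (G : SimpleGraph V) {D : ℕ}
    (hD : ∀ x, G.degree x ≤ D) (Y : Finset V) :
    ∑ x, (G.adjMatrix ℝ *ᵥ ∑ y ∈ Y, Pi.single y 1) x ^ 2 ≤
      MG G ^ 2 * Y.card * (Real.log D + 1) := by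
  simp only [adjMatrix_mulVec_sum_single]
  refine sum_sq_le_of_sum_sq_le_card (fun x => (Y.filter (G.Adj x)).card) (fun x => ?_)
    (by positivity) fun X => ?_
  · refine le_trans (Finset.card_le_card fun y hy => ?_) (hD x)
    simpa using (Finset.mem_filter.1 hy).2
  · rw [← Nat.cast_sum, sum_card_filter_adj_eq_eXY]
    exact eXY_sq_le G X Y

open Classical Matrix in
lemma lamMax_le_sqrt_mul_MG {V : Type*} [Fintype V] [Nonempty V] (G : SimpleGraph V) {D : ℕ}
    (hD : ∀ x, G.degree x ≤ D) :
    lamMax G ≤ √((Real.log D + 1) * ((1 / 4 : ℝ) * Real.log (Fintype.card V) + 1)) * MG G := by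
  obtain ⟨u, hu0, hu⟩ := exists_adjMatrix_mulVec_eq_lamMax_smul G
  have hlogD : 0 ≤ Real.log D + 1 := by linarith [Real.log_natCast_nonneg D]
  have hlogV : 0 ≤ (1 / 4 : ℝ) * Real.log (Fintype.card V) + 1 := by
    linarith [Real.log_natCast_nonneg (Fintype.card V)]
  let T : (V → ℝ) →ₗ[ℝ] EuclideanSpace ℝ V :=
    (WithLp.linearEquiv 2 ℝ (V → ℝ)).symm.toLinearMap ∘ₗ (G.adjMatrix ℝ).mulVecLin
  have hT : ∀ v, ‖T v‖ ^ 2 = ∑ x, (G.adjMatrix ℝ *ᵥ v) x ^ 2 := fun v => by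
    rw [EuclideanSpace.real_norm_sq_eq]
    rfl
  have hind : ∀ Y : Finset V, ‖T (∑ y ∈ Y, Pi.single y 1)‖ ≤
      (MG G * √(Real.log D + 1)) * √(Y.card : ℝ) := by
    intro Y
    have hM := MG_nonneg G
    refine le_of_sq_le_sq ?_ (by positivity)
    rw [hT, mul_pow, mul_pow, Real.sq_sqrt hlogD, Real.sq_sqrt (Nat.cast_nonneg _)]
    exact (sum_sq_adjMatrix_mulVec_indicator_le G hD Y).trans_eq (by ring)
  have key := norm_sq_map_le_of_indicator T hind (g := |u|) fun x => abs_nonneg _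
  have hlow : lamMax G ^ 2 * ∑ x, |u| x ^ 2 ≤ ‖T |u|‖ ^ 2 := by
    rw [hT, Finset.mul_sum]
    refine Finset.sum_le_sum fun x _ => ?_
    have hx := congrFun hu x
    rw [SimpleGraph.adjMatrix_mulVec_apply, Pi.smul_apply, smul_eq_mul] at hx
    rw [SimpleGraph.adjMatrix_mulVec_apply, ← mul_pow, Pi.abs_apply, ← sq_abs, abs_mul, abs_abs,
      ← abs_mul, ← hx]
    simp only [Pi.abs_apply]
    gcongr
    exact Finset.abs_sum_le_sum_abs _ _
  have hpos : 0 < ∑ x, |u| x ^ 2 := by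
    obtain ⟨x, hx⟩ := Function.ne_iff.1 hu0
    refine Finset.sum_pos' (fun x _ => sq_nonneg _) ⟨x, Finset.mem_univ x, ?_⟩
    have : 0 < |u x| := abs_pos.2 hx
    exact pow_pos this 2
  have hsq := le_of_mul_le_mul_right (hlow.trans key) hpos
  refine le_of_sq_le_sq ?_ (mul_nonneg (Real.sqrt_nonneg _) (MG_nonneg G))
  rw [mul_pow, Real.sq_sqrt (mul_nonneg hlogD hlogV)]
  rw [mul_pow, Real.sq_sqrt hlogD] at hsq
  linarith

/-- Theorem 2: `M(G) ≤ λmax(G) ≤ √((log Δ(G) + 1)·((1/4)·log|V| + 1))·M(G)`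
for a graph with at least one edge. -/
theorem statement1 {V : Type*} [Fintype V] (G : SimpleGraph V) [DecidableRel G.Adj]
    (hedge : ∃ a b, G.Adj a b) :
    MG G ≤ lamMax G ∧
      lamMax G ≤ Real.sqrt ((Real.log G.maxDegree + 1) *
        ((1 / 4 : ℝ) * Real.log (Fintype.card V) + 1)) * MG G := by
  have : Nonempty V := ⟨hedge.choose⟩
  constructor
  · obtain ⟨a, -⟩ := hedge
    refine csSup_le ⟨_, {a}, {a}, Finset.singleton_nonempty a, Finset.singleton_nonempty a, rfl⟩ ?_
    rintro r ⟨X, Y, hX, hY, rfl⟩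
    exact eXY_div_sqrt_le_lamMax G hX hY
  · refine lamMax_le_sqrt_mul_MG G fun x => ?_
    convert G.degree_le_maxDegree x
end
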